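/- arXiv:2604.22078 — 3 statements merged into one kernel-verified Lean document; each statement's English description precedes it below -/
import Mathlib

section
/- Let $G$ be a finite group. The following are equivalent: (i) for every nonzero finite-dimensional complex vector space $V$ and every irreducible quandle representation $\rho$ of $Conj(G)$ on $V$, there exist a quandle character $\chi$ of $Conj(G)$ and an irreducible linear group representation $\rho_0 : G \to GL(V)$ such that $\rho(g) = \chi(g) \cdot \rho_0(g)$ for all $g \in G$; (ii) every symmetric 2-cocycle on $G$ with values in $\mathbb{C}^\times$ is a coboundary. -/
theorem aux_schur {G V : Type*} [AddCommGroup V] [Module ℂ V] [FiniteDimensional ℂ V] [Nontrivial V]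
    (ρ : G → (V →ₗ[ℂ] V)ˣ)
    (hirr : ∀ W : Submodule ℂ V,
          (∀ g : G, W.map (ρ g : V →ₗ[ℂ] V) ≤ W) → W = ⊥ ∨ W = ⊤)
    (T : (V →ₗ[ℂ] V)ˣ) (hT : ∀ g, T * ρ g = ρ g * T) :
    ∃ c : ℂˣ, (T : V →ₗ[ℂ] V) = (c : ℂ) • (1 : V →ₗ[ℂ] V) := by
  obtain ⟨μ, hμ⟩ := Module.End.exists_eigenvalue (T : Module.End ℂ V)
  have htop : Module.End.eigenspace (T : Module.End ℂ V) μ = ⊤ := by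
    rcases hirr (Module.End.eigenspace (T : Module.End ℂ V) μ) (by
      intro g
      rintro _ ⟨v, hv, rfl⟩
      have hv' := Module.End.mem_eigenspace_iff.1 hv
      rw [Module.End.mem_eigenspace_iff]
      have h := congrArg (fun u : (V →ₗ[ℂ] V)ˣ => (u : V →ₗ[ℂ] V) v) (hT g)
      simp only [Units.val_mul, Module.End.mul_apply] at h
      rw [h, hv', map_smul]) with h | h
    · exact absurd h hμ
    · exact h
  have hTμ : (T : V →ₗ[ℂ] V) = μ • (1 : V →ₗ[ℂ] V) := by
    ext v
    have hv : v ∈ Module.End.eigenspace (T : Module.End ℂ V) μ := by rw [htop]; trivial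
    simpa using Module.End.mem_eigenspace_iff.1 hv
  have hμ0 : μ ≠ 0 := by
    rintro rfl
    rw [zero_smul] at hTμ
    exact T.ne_zero hTμ
  exact ⟨Units.mk0 μ hμ0, hTμ⟩

theorem aux_cancel {V : Type*} [AddCommGroup V] [Module ℂ V] [Nontrivial V]
    (u : (V →ₗ[ℂ] V)ˣ) (a b : ℂ)
    (h : a • (u : V →ₗ[ℂ] V) = b • (u : V →ₗ[ℂ] V)) : a = b := by
  have hu : (u : V →ₗ[ℂ] V) ≠ 0 := u.ne_zero
  exact smul_left_injective ℂ hu h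

/-- scalar units -/
noncomputable def auxS (V : Type*) [AddCommGroup V] [Module ℂ V] : ℂˣ →* (V →ₗ[ℂ] V)ˣ :=
  Units.map (algebraMap ℂ (Module.End ℂ V)).toMonoidHom

theorem auxS_val {V : Type*} [AddCommGroup V] [Module ℂ V] (c : ℂˣ) :
    (auxS V c : V →ₗ[ℂ] V) = (c : ℂ) • (1 : V →ₗ[ℂ] V) :=
  Algebra.algebraMap_eq_smul_one (A := Module.End ℂ V) (c : ℂ)

theorem auxS_comm {V : Type*} [AddCommGroup V] [Module ℂ V] (c : ℂˣ) (u : (V →ₗ[ℂ] V)ˣ) :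
    u * auxS V c = auxS V c * u := by
  ext1
  rw [Units.val_mul, Units.val_mul]
  exact (Algebra.commutes (A := Module.End ℂ V) (c : ℂ) _).symm

theorem auxS_mul_val {V : Type*} [AddCommGroup V] [Module ℂ V] (c : ℂˣ) (u : (V →ₗ[ℂ] V)ˣ) :
    ((auxS V c * u : (V →ₗ[ℂ] V)ˣ) : V →ₗ[ℂ] V) = (c : ℂ) • (u : V →ₗ[ℂ] V) := by
  rw [Units.val_mul, auxS_val, smul_mul_assoc, one_mul]

theorem auxS_cancel {V : Type*} [AddCommGroup V] [Module ℂ V] [Nontrivial V]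
    {a b : ℂˣ} {u : (V →ₗ[ℂ] V)ˣ} (h : auxS V a * u = auxS V b * u) : a = b := by
  have h' := congrArg Units.val h
  rw [auxS_mul_val, auxS_mul_val] at h'
  exact Units.ext (aux_cancel u _ _ h')

theorem aux_dir2 {G : Type*} [Group G] 
    (hc : ∀ α : G → G → ℂˣ,
      (∀ g h k : G, α g h * α (g * h) k = α h k * α g (h * k)) →
      (∀ g h : G, α g h = α h g) →
      ∃ f : G → ℂˣ, ∀ g h : G, α g h = f g * f h * (f (g * h))⁻¹)
    {V : Type*} [AddCommGroup V] [Module ℂ V] [FiniteDimensional ℂ V] [Nontrivial V]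
    (ρ : G → (V →ₗ[ℂ] V)ˣ)
    (hρ : ∀ g h : G, ρ (g * h * g⁻¹) = ρ g * ρ h * (ρ g)⁻¹)
    (hirr : ∀ W : Submodule ℂ V,
          (∀ g : G, W.map (ρ g : V →ₗ[ℂ] V) ≤ W) → W = ⊥ ∨ W = ⊤) :
    ∃ (χ : G → ℂˣ) (ρ₀ : G →* (V →ₗ[ℂ] V)ˣ),
          (∀ g h : G, χ (g * h * g⁻¹) = χ h) ∧
          (∀ W : Submodule ℂ V,
            (∀ g : G, W.map (ρ₀ g : V →ₗ[ℂ] V) ≤ W) → W = ⊥ ∨ W = ⊤) ∧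
          ∀ g : G, (ρ g : V →ₗ[ℂ] V) = (χ g : ℂ) • (ρ₀ g : V →ₗ[ℂ] V) := by
  have hρ' : ∀ g h, ρ g * ρ h = ρ (g * h * g⁻¹) * ρ g := by intro g h; rw [hρ]; group
  have key : ∀ g h, ∃ c : ℂˣ, ρ g * ρ h = auxS V c * ρ (g * h) := by
    intro g h
    obtain ⟨c, hcc⟩ := aux_schur ρ hirr ((ρ (g * h))⁻¹ * (ρ g * ρ h)) (by
      intro k
      have h1 : ρ g * ρ h * ρ k = ρ (g * h * k * (g * h)⁻¹) * (ρ g * ρ h) := by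
        rw [mul_assoc, hρ' h k, ← mul_assoc, hρ' g, mul_assoc]
        congr 2; group
      have h2 := hρ' (g * h) k
      rw [mul_assoc, h1, inv_mul_eq_iff_eq_mul, ← mul_assoc, ← mul_assoc, h2]
      group)
    refine ⟨c, ?_⟩
    have : (ρ (g * h))⁻¹ * (ρ g * ρ h) = auxS V c := by
      ext1; rw [hcc, auxS_val]
    rw [← auxS_comm, ← this]; group
  choose β hβ using key
  have hco : ∀ g h k : G, β g h * β (g * h) k = β h k * β g (h * k) := by
    intro g h k
    apply auxS_cancel (V := V) (u := ρ (g * h * k))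
    have e1 : ρ g * ρ h * ρ k = auxS V (β g h * β (g * h) k) * ρ (g * h * k) := by
      rw [hβ, mul_assoc, hβ, ← mul_assoc, map_mul]
    have e2 : ρ g * (ρ h * ρ k) = auxS V (β h k * β g (h * k)) * ρ (g * h * k) := by
      rw [hβ, ← mul_assoc, auxS_comm, mul_assoc, hβ, ← mul_assoc, map_mul, mul_assoc g]
    rw [← e1, ← e2, mul_assoc]
  have hsym : ∀ g h : G, β g h = β h g := by
    intro g h
    apply auxS_cancel (V := V) (u := ρ g * ρ (h * g))
    -- ρ g ρ (hg) = ρ (gh) ρ g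
    have e : ρ g * ρ (h * g) = ρ (g * h) * ρ g := by
      rw [hρ']; congr 2; group
    calc auxS V (β g h) * (ρ g * ρ (h * g)) = ρ g * ρ h * ρ g := by
          rw [e, ← mul_assoc, ← hβ]
      _ = auxS V (β h g) * (ρ g * ρ (h * g)) := by
          rw [mul_assoc, hβ h g, ← mul_assoc, auxS_comm, mul_assoc]
  obtain ⟨f, hf⟩ := hc β hco hsym
  let ρ₀ : G →* (V →ₗ[ℂ] V)ˣ := MonoidHom.mk' (fun g => auxS V (f g)⁻¹ * ρ g) (by
    intro g h
    have : auxS V (f g)⁻¹ * ρ g * (auxS V (f h)⁻¹ * ρ h)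
        = auxS V ((f g)⁻¹ * (f h)⁻¹ * β g h) * ρ (g * h) := by
      rw [map_mul, mul_assoc, mul_assoc _ (auxS V (β g h)), ← hβ, ← mul_assoc (ρ g), auxS_comm, map_mul]
      simp only [mul_assoc]
    rw [this, hf]
    congr 2
    rw [show (f g)⁻¹ * (f h)⁻¹ * (f g * f h * (f (g * h))⁻¹) = ((f g)⁻¹ * f g) * ((f h)⁻¹ * f h) * (f (g * h))⁻¹ by
      ac_rfl]
    simp)
  have hρ₀ : ∀ g, ρ g = auxS V (f g) * ρ₀ g := by
    intro g
    change ρ g = auxS V (f g) * (auxS V (f g)⁻¹ * ρ g)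
    rw [← mul_assoc, ← map_mul]; simp
  refine ⟨f, ρ₀, ?_, ?_, ?_⟩
  · intro g h
    apply auxS_cancel (V := V) (u := ρ₀ (g * h * g⁻¹))
    rw [← hρ₀, hρ, hρ₀ g, hρ₀ h, map_mul, map_mul, map_inv, mul_inv_rev, ← mul_assoc (auxS V (f h)),
      ← mul_assoc (auxS V (f h)), ← auxS_comm (f h), mul_assoc (auxS V (f g)), ← mul_assoc (ρ₀ g), auxS_comm (f h)]
    have : ∀ x : (V →ₗ[ℂ] V)ˣ, x * (auxS V (f g))⁻¹ = (auxS V (f g))⁻¹ * x := by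
      intro x; rw [← map_inv]; exact auxS_comm _ _
    rw [← mul_assoc, this]
    group
  · intro W hW
    apply hirr W
    intro g
    rintro _ ⟨v, hv, rfl⟩
    rw [hρ₀, auxS_mul_val]
    exact W.smul_mem _ (hW g ⟨v, hv, rfl⟩)
  · intro g
    rw [← auxS_mul_val, ← hρ₀]

theorem aux_dir1 {G : Type*} [Group G] [Finite G] 
    (H : ∀ (V : Type) (_ : AddCommGroup V) (_ : Module ℂ V),
      FiniteDimensional ℂ V → Nontrivial V →
      ∀ ρ : G → (V →ₗ[ℂ] V)ˣ,
        (∀ g h : G, ρ (g * h * g⁻¹) = ρ g * ρ h * (ρ g)⁻¹) →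
        (∀ W : Submodule ℂ V,
          (∀ g : G, W.map (ρ g : V →ₗ[ℂ] V) ≤ W) → W = ⊥ ∨ W = ⊤) →
        ∃ (χ : G → ℂˣ) (ρ₀ : G →* (V →ₗ[ℂ] V)ˣ),
          (∀ g h : G, χ (g * h * g⁻¹) = χ h) ∧
          (∀ W : Submodule ℂ V,
            (∀ g : G, W.map (ρ₀ g : V →ₗ[ℂ] V) ≤ W) → W = ⊥ ∨ W = ⊤) ∧
          ∀ g : G, (ρ g : V →ₗ[ℂ] V) = (χ g : ℂ) • (ρ₀ g : V →ₗ[ℂ] V))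
    (α : G → G → ℂˣ)
    (hα : ∀ g h k : G, α g h * α (g * h) k = α h k * α g (h * k))
    (hs : ∀ g h : G, α g h = α h g) :
      ∃ f : G → ℂˣ, ∀ g h : G, α g h = f g * f h * (f (g * h))⁻¹ := by
  obtain ⟨n, ⟨e⟩⟩ := Finite.exists_equiv_fin G
  let L : G → ((Fin n → ℂ) →ₗ[ℂ] (Fin n → ℂ)) := fun g =>
    { toFun := fun v x => (α g (g⁻¹ * e.symm x) : ℂ) * v (e (g⁻¹ * e.symm x))
      map_add' := by intro v w; ext x; simp [mul_add]
      map_smul' := by intro c v; ext x; simp; ring }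
  have hL : ∀ g v x, L g v x = (α g (g⁻¹ * e.symm x) : ℂ) * v (e (g⁻¹ * e.symm x)) :=
    fun _ _ _ => rfl
  have hLmul : ∀ g h v, L g (L h v) = (α g h : ℂ) • L (g * h) v := by
    intro g h v
    ext x
    have h1 := hα g h ((g * h)⁻¹ * e.symm x)
    have h2 := congrArg Units.val h1
    have h3 : h * ((g * h)⁻¹ * e.symm x) = g⁻¹ * e.symm x := by group
    have h4 : h⁻¹ * (g⁻¹ * e.symm x) = (g * h)⁻¹ * e.symm x := by group
    rw [h3] at h2
    push_cast at h2
    rw [Pi.smul_apply, smul_eq_mul]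
    simp only [hL, Equiv.symm_apply_apply]
    rw [h4, ← mul_assoc, ← mul_assoc, h2]
    ring
  have hLinj : ∀ g v, L g v = 0 → v = 0 := by
    intro g v hv
    ext y
    have := congrFun hv (e (g * e.symm y))
    rw [hL] at this
    simpa using this
  have : Nonempty (Fin n) := ⟨e 1⟩
  obtain ⟨W, ⟨hW0, hWi⟩, hWmin⟩ := WellFounded.has_min
    (wellFounded_lt (α := Submodule ℂ (Fin n → ℂ)))
    {W | W ≠ ⊥ ∧ ∀ g, ∀ v ∈ W, L g v ∈ W} ⟨⊤, top_ne_bot, fun _ _ _ => trivial⟩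
  have hnt : Nontrivial W := Submodule.nontrivial_iff_ne_bot.2 hW0
  have hu : ∀ g, IsUnit ((L g).restrict (hWi g) : W →ₗ[ℂ] W) := by
    intro g
    refine (LinearMap.isUnit_iff_ker_eq_bot _).2 ?_
    rw [LinearMap.ker_eq_bot']
    intro v hv
    have := congrArg Subtype.val hv
    exact Subtype.ext (hLinj g _ this)
  let ρ : G → (W →ₗ[ℂ] W)ˣ := fun g => (hu g).unit
  have hρv : ∀ g (w : W), (((ρ g : W →ₗ[ℂ] W) w : W) : Fin n → ℂ) = L g w := fun _ _ => rfl
  have hρm : ∀ g h, ρ g * ρ h = auxS W (α g h) * ρ (g * h) := by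
    intro g h
    apply Units.ext
    rw [auxS_mul_val]
    refine LinearMap.ext fun w => Subtype.ext ?_
    exact hLmul g h w
  obtain ⟨χ, ρ₀, -, -, h3⟩ := H W inferInstance inferInstance inferInstance hnt ρ (by
    intro g h
    rw [eq_mul_inv_iff_mul_eq]
    have hxg := hρm (h * g⁻¹) g
    have hgx := hρm g (h * g⁻¹)
    rw [inv_mul_cancel_right] at hxg
    rw [hs, ← mul_assoc] at hgx
    apply mul_left_cancel (a := auxS W (α (h * g⁻¹) g))
    rw [← mul_assoc, ← hgx, mul_assoc, hxg, ← mul_assoc, auxS_comm, mul_assoc]) (by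
    intro W' hW'
    by_cases hb : W' = ⊥
    · exact Or.inl hb
    right
    have hmem : W'.map W.subtype ∈ {W | W ≠ ⊥ ∧ ∀ g, ∀ v ∈ W, L g v ∈ W} := by
      refine ⟨?_, ?_⟩
      · intro h0
        apply hb
        apply Submodule.map_injective_of_injective W.injective_subtype
        rw [h0, Submodule.map_bot]
      · rintro g _ ⟨w, hw, rfl⟩
        exact ⟨(ρ g : W →ₗ[ℂ] W) w, hW' g ⟨w, hw, rfl⟩, rfl⟩
    have hnl := hWmin _ hmem
    have hle : W'.map W.subtype ≤ W := Submodule.map_subtype_le W W'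
    have heq : W'.map W.subtype = W := by
      by_contra hne
      exact hnl (lt_of_le_of_ne hle hne)
    rw [eq_top_iff]
    rintro w -
    have hw : (w : Fin n → ℂ) ∈ W'.map W.subtype := by rw [heq]; exact w.2
    obtain ⟨w', hw', h⟩ := hw
    have : w' = w := Subtype.ext h
    exact this ▸ hw')
  have h3' : ∀ g, ρ g = auxS W (χ g) * ρ₀ g := by
    intro g; apply Units.ext; rw [auxS_mul_val, h3]
  refine ⟨χ, fun g h => ?_⟩
  rw [eq_mul_inv_iff_mul_eq]
  apply auxS_cancel (V := W) (u := ρ₀ (g * h))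
  have e1 : ρ g * ρ h = auxS W (χ g * χ h) * ρ₀ (g * h) := by
    rw [h3' g, h3' h, mul_assoc, ← mul_assoc (ρ₀ g), auxS_comm, map_mul, map_mul]
    simp only [mul_assoc]
  rw [← e1, hρm, h3' (g * h), map_mul, mul_assoc]

/-- For a finite group `G`: every irreducible quandle representation of `Conj(G)`
over `ℂ` is of the form `χ · ρ₀` with `χ` a quandle character and `ρ₀` an irreducible linear
group representation, if and only if every symmetric 2-cocycle of `G` with values in `ℂˣ` is
a coboundary. -/
theorem stmt5 {G : Type*} [Group G] [Finite G] :
    (∀ (V : Type) (_ : AddCommGroup V) (_ : Module ℂ V),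
      FiniteDimensional ℂ V → Nontrivial V →
      ∀ ρ : G → (V →ₗ[ℂ] V)ˣ,
        (∀ g h : G, ρ (g * h * g⁻¹) = ρ g * ρ h * (ρ g)⁻¹) →
        (∀ W : Submodule ℂ V,
          (∀ g : G, W.map (ρ g : V →ₗ[ℂ] V) ≤ W) → W = ⊥ ∨ W = ⊤) →
        ∃ (χ : G → ℂˣ) (ρ₀ : G →* (V →ₗ[ℂ] V)ˣ),
          (∀ g h : G, χ (g * h * g⁻¹) = χ h) ∧
          (∀ W : Submodule ℂ V,
            (∀ g : G, W.map (ρ₀ g : V →ₗ[ℂ] V) ≤ W) → W = ⊥ ∨ W = ⊤) ∧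
          ∀ g : G, (ρ g : V →ₗ[ℂ] V) = (χ g : ℂ) • (ρ₀ g : V →ₗ[ℂ] V)) ↔
    (∀ α : G → G → ℂˣ,
      (∀ g h k : G, α g h * α (g * h) k = α h k * α g (h * k)) →
      (∀ g h : G, α g h = α h g) →
      ∃ f : G → ℂˣ, ∀ g h : G, α g h = f g * f h * (f (g * h))⁻¹) := by
  constructor
  · intro H α hα hs
    exact aux_dir1 H α hα hs
  · intro hc V _ _ hfd hnt ρ hρ hirr
    exact aux_dir2 hc ρ hρ hirr
end

section
/- Let $G$ be a finite group, $\pi : A(G) \to G$ the unique group homomorphism with $\pi \circ \varphi_G = \mathrm{id}_G$, and $Z_1 = \ker \pi$. Then $Z_1$ is torsion-free (every element of $Z_1$ other than the identity has infinite order) if and only if every symmetric 2-cocycle on $G$ with values in $\mathbb{C}^\times$ is a coboundary. -/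
namespace EnvAux

open Rack

theorem ext_char {M N : Type*} [CommGroup M] [CommGroup N] (f : M →* N)
    (hf : Function.Injective f) (g : M →* ℂˣ) : ∃ h : N →* ℂˣ, ∀ x, h (f x) = g x := by
  have hsurj : ∀ {n : ℤ}, n ≠ 0 → Function.Surjective (fun a => n • a : Additive ℂˣ → Additive ℂˣ) := by
    have key : ∀ n : ℕ, n ≠ 0 → ∀ a : ℂˣ, ∃ b : ℂˣ, b ^ n = a := by
      intro n hn a
      obtain ⟨z, hz⟩ := IsAlgClosed.exists_pow_nat_eq (a : ℂ) (Nat.pos_of_ne_zero hn)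
      have hz0 : z ≠ 0 := by
        rintro rfl
        rw [zero_pow hn] at hz
        exact a.ne_zero hz.symm
      exact ⟨Units.mk0 z hz0, Units.ext (by simpa using hz)⟩
    intro n hn a
    obtain ⟨b, hb⟩ := key n.natAbs (by simpa using hn) a.toMul
    rcases Int.natAbs_eq n with h | h
    · refine ⟨Additive.ofMul b, ?_⟩
      apply Additive.toMul.injective
      show b ^ n = _
      rw [h, zpow_natCast, hb]
    · refine ⟨Additive.ofMul b⁻¹, ?_⟩
      apply Additive.toMul.injective
      show b⁻¹ ^ n = _
      rw [h, zpow_neg, zpow_natCast, inv_pow, inv_inv, hb]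
  letI : DivisibleBy (Additive ℂˣ) ℤ := divisibleByOfSMulRightSurj _ _ hsurj
  obtain ⟨h, hh⟩ := (Module.Baer.of_divisible (Additive ℂˣ)).extension_property_addMonoidHom
    (MonoidHom.toAdditive f) (fun x y hxy => hf hxy) (MonoidHom.toAdditive g)
  exact ⟨MonoidHom.toAdditive.symm h, fun x => DFunLike.congr_fun hh x⟩

theorem ext_central {A : Type*} [Group A] (Z : Subgroup A) (hZ : Z ≤ Subgroup.center A)
    (htriv : ∀ z ∈ Z, z ∈ commutator A → z = 1) (χ : Z →* ℂˣ) :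
    ∃ F : A →* ℂˣ, ∀ z : Z, F z = χ z := by
  letI : CommGroup Z := { (inferInstance : Group Z) with
    mul_comm := fun a b => Subtype.ext (Subgroup.mem_center_iff.1 (hZ b.2) a) }
  obtain ⟨h, hh⟩ := ext_char ((Abelianization.of (G := A)).comp Z.subtype) (by
    rw [injective_iff_map_eq_one]
    intro z hz
    apply Subtype.ext
    apply htriv z z.2
    rw [← Abelianization.ker_of]
    exact hz) χ
  exact ⟨h.comp Abelianization.of, hh⟩

theorem exists_char {M : Type*} [CommGroup M] (z : M) (hz : z ≠ 1) (hf : IsOfFinOrder z) :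
    ∃ χ : M →* ℂˣ, χ z ≠ 1 := by
  haveI : Finite (Subgroup.zpowers z) := by
    exact finite_zpowers.2 hf
  haveI : NeZero (Monoid.exponent (Subgroup.zpowers z)) := ⟨Monoid.exponent_ne_zero_of_finite⟩
  obtain ⟨φ, hφ⟩ := CommGroup.exists_apply_ne_one_of_hasEnoughRootsOfUnity (Subgroup.zpowers z) ℂ
    (a := ⟨z, Subgroup.mem_zpowers z⟩) (by simpa [Subtype.ext_iff] using hz)
  obtain ⟨h, hh⟩ := ext_char (Subgroup.zpowers z).subtype Subtype.val_injective φ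
  exact ⟨h, by rw [← hh] at hφ; exact hφ⟩

/-- The generator map. -/
def ph {G : Type*} [Group G] (g : G) : EnvelGroup (Quandle.Conj G) :=
  toEnvelGroup (Quandle.Conj G) g

theorem ph_conj {G : Type*} [Group G] (g h : G) : ph g * ph h * (ph g)⁻¹ = ph (g * h * g⁻¹) :=
  ((toEnvelGroup (Quandle.Conj G)).map_act (x := g) (y := h)).symm

theorem ind {G : Type*} [Group G] (S : Subgroup (EnvelGroup (Quandle.Conj G)))
    (h : ∀ g, ph g ∈ S) (a : EnvelGroup (Quandle.Conj G)) : a ∈ S := by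
  refine Quotient.inductionOn a fun x => ?_
  induction x with
  | unit => exact S.one_mem
  | incl x => exact h x
  | mul x y hx hy => exact S.mul_mem hx hy
  | inv x hx => exact S.inv_mem hx

theorem hom_ext {G H : Type*} [Group G] [Group H] (F F' : EnvelGroup (Quandle.Conj G) →* H)
    (h : ∀ g, F (ph g) = F' (ph g)) (a) : F a = F' a :=
  ind (F.eqLocus F') h a

theorem exists_lift {G H : Type*} [Group G] [Group H] (f : G → H)
    (h : ∀ x y, f (x * y * x⁻¹) = f x * f y * (f x)⁻¹) :
    ∃ F : EnvelGroup (Quandle.Conj G) →* H, ∀ g, F (ph g) = f g :=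
  ⟨toEnvelGroup.map (R := Quandle.Conj G) { toFun := f, map_act' := fun {x y} => h x y },
    fun _ => rfl⟩

section
variable {G : Type*} [Group G] (π : EnvelGroup (Quandle.Conj G) →* G)
    (hπ : ∀ g : G, π (ph g) = g)
include hπ

theorem conj_all (a : EnvelGroup (Quandle.Conj G)) (g : G) :
    a * ph g * a⁻¹ = ph (π a * g * (π a)⁻¹) := by
  let S : Subgroup (EnvelGroup (Quandle.Conj G)) :=
    { carrier := {a | ∀ g, a * ph g * a⁻¹ = ph (π a * g * (π a)⁻¹)}
      one_mem' := by simp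
      mul_mem' := by
        intro a b ha hb g
        have : a * b * ph g * (a * b)⁻¹ = a * (b * ph g * b⁻¹) * a⁻¹ := by group
        rw [this, hb, ha]
        congr 1
        simp only [map_mul]; group
      inv_mem' := by
        intro a ha g
        have := ha ((π a)⁻¹ * g * π a)
        have e : π a * ((π a)⁻¹ * g * π a) * (π a)⁻¹ = g := by group
        rw [e] at this
        rw [← this]
        simp only [map_inv, inv_inv]; group }
  exact ind S (fun x g => by rw [hπ]; exact ph_conj x g) a g

theorem ker_le : π.ker ≤ Subgroup.center _ := by
  intro z hz
  rw [Subgroup.mem_center_iff]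
  intro a
  refine ind (Subgroup.centralizer {z}) (fun g => ?_) a |> fun h => (Subgroup.mem_centralizer_singleton_iff.1 h)
  rw [Subgroup.mem_centralizer_singleton_iff]
  have := conj_all π hπ z g
  rw [MonoidHom.mem_ker.1 hz] at this
  simp only [one_mul, inv_one, mul_one] at this
  rw [mul_inv_eq_iff_eq_mul] at this
  exact this.symm

end

/-- The central extension attached to a cocycle. -/
structure Ext {G : Type*} (α : G → G → ℂˣ) where
  /-- central part -/
  c : ℂˣ
  /-- group part -/
  g : G

attribute [ext] Ext

section
variable {G : Type*} [Group G] {α : G → G → ℂˣ}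

theorem one_left (hα : ∀ g h k : G, α g h * α (g * h) k = α h k * α g (h * k)) (k : G) :
    α 1 k = α 1 1 := by
  have := hα 1 1 k
  simp only [one_mul] at this
  rw [mul_comm] at this
  exact (mul_left_cancel this).symm

theorem one_right (hα : ∀ g h k : G, α g h * α (g * h) k = α h k * α g (h * k)) (k : G) :
    α k 1 = α 1 1 := by
  have := hα k 1 1
  simp only [mul_one] at this
  exact mul_right_cancel this

/-- Group structure on the extension. -/
@[reducible]
noncomputable def extGroup (hα : ∀ g h k : G, α g h * α (g * h) k = α h k * α g (h * k)) :
    Group (Ext α) :=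
  letI : Mul (Ext α) := ⟨fun x y => ⟨x.c * y.c * α x.g y.g, x.g * y.g⟩⟩
  letI : One (Ext α) := ⟨⟨(α 1 1)⁻¹, 1⟩⟩
  letI : Inv (Ext α) := ⟨fun x => ⟨x.c⁻¹ * (α x.g⁻¹ x.g)⁻¹ * (α 1 1)⁻¹, x.g⁻¹⟩⟩
  Group.ofLeftAxioms
    (by
      intro x y z
      apply Ext.ext
      · show x.c * y.c * α x.g y.g * z.c * α (x.g * y.g) z.g
          = x.c * (y.c * z.c * α y.g z.g) * α x.g (y.g * z.g)
        have := hα x.g y.g z.g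
        calc _ = x.c * y.c * z.c * (α x.g y.g * α (x.g * y.g) z.g) := by
              simp only [mul_assoc, mul_left_comm, mul_comm]
          _ = _ := by rw [this]; simp only [mul_assoc]
      · exact mul_assoc x.g y.g z.g)
    (by
      intro x
      apply Ext.ext
      · show (α 1 1)⁻¹ * x.c * α 1 x.g = x.c
        rw [one_left hα x.g, mul_comm, mul_inv_cancel_left]
      · exact one_mul x.g)
    (by
      intro x
      apply Ext.ext
      · show x.c⁻¹ * (α x.g⁻¹ x.g)⁻¹ * (α 1 1)⁻¹ * x.c * α x.g⁻¹ x.g = (α 1 1)⁻¹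
        rw [mul_right_comm _ x.c, mul_right_comm _ (α 1 1)⁻¹, inv_mul_cancel_right,
          mul_right_comm, inv_mul_cancel, one_mul]
      · exact inv_mul_cancel x.g)

theorem alpha_conj (hα : ∀ g h k : G, α g h * α (g * h) k = α h k * α g (h * k))
    (hs : ∀ g h, α g h = α h g) (g x : G) : α (g * x * g⁻¹) g = α g x := by
  -- from the cocycle identity for (g, x g⁻¹, g)
  have h := hα g (x * g⁻¹) g
  rw [hs g (x * g⁻¹), hs (x * g⁻¹) g] at h
  simp only [inv_mul_cancel_right] at h
  rw [← mul_assoc] at h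
  exact mul_left_cancel ((congrArg (· * _) (hs g (x * g⁻¹))).trans (by rw [hs g (x*g⁻¹)] at *; exact h))

theorem exists_chi (hα : ∀ g h k : G, α g h * α (g * h) k = α h k * α g (h * k))
    (hs : ∀ g h, α g h = α h g) (π : EnvelGroup (Quandle.Conj G) →* G)
    (hπ : ∀ g : G, π (ph g) = g) :
    ∃ χ : π.ker →* ℂˣ, ∀ (g h : G) (z : π.ker),
      (z : EnvelGroup (Quandle.Conj G)) * ph (g * h) = ph g * ph h → χ z = α g h := by
  letI := extGroup hα
  have mul_def : ∀ x y : Ext α, x * y = ⟨x.c * y.c * α x.g y.g, x.g * y.g⟩ := fun _ _ => rfl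
  obtain ⟨Φ, hΦ⟩ := exists_lift (G := G) (H := Ext α) (fun g => ⟨1, g⟩) (by
    intro x y
    rw [eq_mul_inv_iff_mul_eq, mul_def, mul_def]
    apply Ext.ext
    · simp [alpha_conj hα hs]
    · simp)
  let p : Ext α →* G := { toFun := Ext.g, map_one' := rfl, map_mul' := fun _ _ => rfl }
  have hp : ∀ a, (Φ a).g = π a := hom_ext (p.comp Φ) π (fun g => by
    rw [hπ, MonoidHom.comp_apply, hΦ]; rfl)
  refine ⟨{ toFun := fun z => (Φ z).c * α 1 1, map_one' := ?_, map_mul' := ?_ }, ?_⟩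
  · simp only [OneMemClass.coe_one, map_one]
    exact inv_mul_cancel _
  · intro z w
    simp only [Subgroup.coe_mul, map_mul]
    rw [mul_def]
    simp only [hp, MonoidHom.mem_ker.1 z.2, MonoidHom.mem_ker.1 w.2]
    simp only [mul_assoc, mul_left_comm, mul_comm]
  · intro g h z hz
    have := congrArg (fun a => (Φ a).c) hz
    simp only [map_mul, hΦ, mul_def, hp, MonoidHom.mem_ker.1 z.2, one_left hα, mul_one, one_mul] at this
    exact this

end

theorem comm_tors {A : Type*} [Group A] [(Subgroup.center A).FiniteIndex] (z : A)
    (hzc : z ∈ commutator A) : IsOfFinOrder z := by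
  let iC : CommGroup (Subgroup.center A) := { (inferInstance : Group (Subgroup.center A)) with
    mul_comm := fun a b => Subtype.ext (Subgroup.mem_center_iff.1 b.2 a) }
  have h2 := Abelianization.commutator_subset_ker (MonoidHom.transferCenterPow A) hzc
  rw [MonoidHom.mem_ker] at h2
  have h3 := congrArg Subtype.val h2
  rw [isOfFinOrder_iff_pow_eq_one]
  exact ⟨_, Nat.pos_of_ne_zero Subgroup.FiniteIndex.index_ne_zero, h3⟩

theorem forward {G : Type*} [Group G] [Finite G]
    (π : EnvelGroup (Quandle.Conj G) →* G) (hπ : ∀ g : G, π (ph g) = g)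
    (htf : ∀ z ∈ π.ker, z ≠ 1 → ¬ IsOfFinOrder z) (α : G → G → ℂˣ)
    (hα : ∀ g h k : G, α g h * α (g * h) k = α h k * α g (h * k))
    (hs : ∀ g h, α g h = α h g) :
    ∃ f : G → ℂˣ, ∀ g h : G, α g h = f g * f h * (f (g * h))⁻¹ := by
  have hc := ker_le π hπ
  haveI : π.ker.FiniteIndex := inferInstance
  haveI : (Subgroup.center (EnvelGroup (Quandle.Conj G))).FiniteIndex :=
    Subgroup.finiteIndex_of_le hc
  obtain ⟨χ, hχ⟩ := exists_chi hα hs π hπ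
  obtain ⟨F, hF⟩ := ext_central π.ker hc (by
    intro z hz hzc
    by_contra h1
    apply htf z hz h1
    exact comm_tors z hzc) χ
  refine ⟨fun g => F (ph g), fun g h => ?_⟩
  have hz : ph g * ph h * (ph (g * h))⁻¹ ∈ π.ker := by
    rw [MonoidHom.mem_ker]; simp [hπ]
  rw [← hχ g h ⟨_, hz⟩ (by simp), ← hF]
  simp

theorem torsion_trivial {G : Type*} [Group G] [Finite G]
    (F : EnvelGroup (Quandle.Conj G) →* ℂˣ) (z) (hz : IsOfFinOrder z) : F z = 1 := by
  classical
  haveI : Fintype (ConjClasses G) := Fintype.ofFinite _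
  have he : ∀ c : ConjClasses G, ∃ e : EnvelGroup (Quandle.Conj G) →* Multiplicative ℤ,
      ∀ g, e (ph g) = if ConjClasses.mk g = c then Multiplicative.ofAdd 1 else 1 := by
    intro c
    apply exists_lift
    intro x y
    rw [mul_comm, inv_mul_cancel_left]
    have : ConjClasses.mk (x * y * x⁻¹) = ConjClasses.mk y := by
      rw [ConjClasses.mk_eq_mk_iff_isConj, isConj_comm, isConj_iff]
      exact ⟨x, rfl⟩
    rw [this]
  choose e hee using he
  let P : EnvelGroup (Quandle.Conj G) →* ℂˣ :=
    ∏ c : ConjClasses G, (zpowersHom ℂˣ (F (ph (Quotient.out c)))).comp (e c)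
  have hP : F z = P z := by
    apply hom_ext
    intro g
    simp only [P, MonoidHom.finsetProd_apply, MonoidHom.comp_apply, hee]
    rw [Finset.prod_eq_single (ConjClasses.mk g)]
    · simp only [if_true, zpowersHom_apply, toAdd_ofAdd, zpow_one]
      have h1 : ConjClasses.mk (Quotient.out (ConjClasses.mk g)) = ConjClasses.mk g :=
        Quotient.out_eq _
      rw [ConjClasses.mk_eq_mk_iff_isConj, isConj_iff] at h1
      obtain ⟨x, hx⟩ := h1
      conv_lhs => rw [← hx]
      rw [← ph_conj]
      simp only [map_mul, map_inv]
      rw [mul_comm, inv_mul_cancel_left]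
    · intro c _ hc
      rw [if_neg (Ne.symm hc), map_one]
    · simp
  rw [hP]
  simp only [P, MonoidHom.finsetProd_apply, MonoidHom.comp_apply]
  apply Finset.prod_eq_one
  intro c _
  have : e c z = 1 := by
    obtain ⟨n, hn, h⟩ := isOfFinOrder_iff_pow_eq_one.1 hz
    have h2 : (e c z) ^ n = 1 := by rw [← map_pow, h, map_one]
    have h3 : n • (e c z).toAdd = 0 := by rw [← toAdd_pow, h2]; rfl
    rcases smul_eq_zero.1 h3 with h4 | h4
    · omega
    · exact h4
  rw [this, map_one]

theorem backward {G : Type*} [Group G] [Finite G]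
    (π : EnvelGroup (Quandle.Conj G) →* G) (hπ : ∀ g : G, π (ph g) = g)
    (H : ∀ α : G → G → ℂˣ,
        (∀ g h k : G, α g h * α (g * h) k = α h k * α g (h * k)) →
        (∀ g h : G, α g h = α h g) →
        ∃ f : G → ℂˣ, ∀ g h : G, α g h = f g * f h * (f (g * h))⁻¹)
    (z) (hz : z ∈ π.ker) (h1 : z ≠ 1) : ¬ IsOfFinOrder z := by
  intro hfin
  have hc := ker_le π hπ
  let C : Subgroup (EnvelGroup (Quandle.Conj G)) := Subgroup.center (EnvelGroup (Quandle.Conj G))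
  let iC : CommGroup C := { (inferInstance : Group C) with
    mul_comm := fun a b => Subtype.ext (Subgroup.mem_center_iff.1 b.2 a) }
  have hz' : (⟨z, hc hz⟩ : C) ≠ 1 := by simpa [Subtype.ext_iff] using h1
  obtain ⟨χ, hχ⟩ := exists_char (⟨z, hc hz⟩ : C) hz' (by
    obtain ⟨n, hn, h⟩ := isOfFinOrder_iff_pow_eq_one.1 hfin
    exact isOfFinOrder_iff_pow_eq_one.2 ⟨n, hn, Subtype.ext h⟩)
  let b : G → G → C := fun g h => ⟨ph g * ph h * (ph (g * h))⁻¹, hc (by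
    rw [MonoidHom.mem_ker]; simp [hπ])⟩
  have hb : ∀ g h, ph g * ph h = (b g h : EnvelGroup (Quandle.Conj G)) * ph (g * h) := by
    intro g h; simp [b]
  have comm : ∀ (w : C) (a : EnvelGroup (Quandle.Conj G)), a * w = w * a :=
    fun w a => Subgroup.mem_center_iff.1 w.2 a
  obtain ⟨f, hf⟩ := H (fun g h => χ (b g h)) (by
    intro g h k
    rw [← map_mul, ← map_mul]
    congr 1
    apply Subtype.ext
    apply mul_right_cancel (b := ph (g * h * k))
    rw [Subgroup.coe_mul, Subgroup.coe_mul, mul_assoc, ← hb, ← mul_assoc, ← hb, mul_assoc (b h k).1,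
      mul_assoc g h k, ← hb, mul_assoc, hb h k, ← mul_assoc, comm, mul_assoc]) (by
    intro g h
    congr 1
    apply Subtype.ext
    apply mul_right_cancel (b := ph (g * h))
    rw [← hb]
    have e : ph (g * h) = ph g * ph (h * g) * (ph g)⁻¹ := by
      rw [ph_conj]; congr 1; group
    rw [e, ← mul_assoc, ← mul_assoc, ← comm, mul_assoc (ph g), ← hb]
    group)
  have hr : ∀ a, a * (ph (π a))⁻¹ ∈ C := fun a => hc (by rw [MonoidHom.mem_ker]; simp [hπ])
  let r : EnvelGroup (Quandle.Conj G) → C := fun a => ⟨a * (ph (π a))⁻¹, hr a⟩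
  have hrr : ∀ a, a = r a * ph (π a) := by intro a; simp [r]
  have hrmul : ∀ a a', r (a * a') = r a * r a' * b (π a) (π a') := by
    intro a a'
    apply Subtype.ext
    apply mul_right_cancel (b := ph (π (a * a')))
    rw [← hrr, map_mul, Subgroup.coe_mul, Subgroup.coe_mul, mul_assoc, ← hb]
    conv_lhs => rw [hrr a, hrr a']
    rw [mul_assoc, ← mul_assoc (ph _), comm (r a')]
    simp only [mul_assoc]
  let F : EnvelGroup (Quandle.Conj G) →* ℂˣ := MonoidHom.mk' (fun a => χ (r a) * f (π a)) (by
    intro a a'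
    simp only [hrmul, map_mul, hf]
    rw [mul_assoc (χ (r a) * χ (r a')), inv_mul_cancel_right]
    simp only [mul_assoc, mul_left_comm, mul_comm])
  apply hχ
  have h2 := torsion_trivial F z hfin
  have h3 : χ (r z) * f (π z) = 1 := h2
  have h4 : χ (r 1) * f (π 1) = 1 := map_one F
  have h5 : r z = ⟨z, hc hz⟩ * r 1 := by
    apply Subtype.ext
    simp [r, MonoidHom.mem_ker.1 hz]
  rw [MonoidHom.mem_ker.1 hz, h5, map_mul, mul_assoc] at h3
  rw [map_one] at h4
  rwa [h4, mul_one] at h3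

end EnvAux

/-- For a finite group `G`, with `π : A(G) → G` the canonical homomorphism and
`Z₁ = ker π`, `Z₁` is torsion-free iff every symmetric 2-cocycle on `G` with values in `ℂˣ`
is a coboundary. -/
theorem stmt16 {G : Type*} [Group G] [Finite G]
    (π : Rack.EnvelGroup (Quandle.Conj G) →* G)
    (hπ : ∀ g : G, π (Rack.toEnvelGroup (Quandle.Conj G) g) = g) :
    (∀ z ∈ π.ker, z ≠ 1 → ¬ IsOfFinOrder z) ↔
      (∀ α : G → G → ℂˣ,
        (∀ g h k : G, α g h * α (g * h) k = α h k * α g (h * k)) →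
        (∀ g h : G, α g h = α h g) →
        ∃ f : G → ℂˣ, ∀ g h : G, α g h = f g * f h * (f (g * h))⁻¹) := by
  exact ⟨fun h α hα hs => EnvAux.forward π hπ h α hα hs,
    fun H z hz h1 => EnvAux.backward π hπ H z hz h1⟩
end

section
/- Let $G$ be a finite group, $\pi : A(G) \to G$ the unique group homomorphism with $\pi \circ \varphi_G = \mathrm{id}_G$, and $Ab : A(G) \to A(G)^{ab}$ the abelianization map. Then the group homomorphism $\pi \times Ab : A(G) \to G \times A(G)^{ab}$, $a \mapsto (\pi(a), Ab(a))$, is injective if and only if every symmetric 2-cocycle on $G$ with values in $\mathbb{C}^\times$ is a coboundary. -/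
section Helpers

theorem aux_extend {M N : Type*} [CommGroup M] [CommGroup N] (i : M →* N)
    (hi : Function.Injective i) (χ : M →* ℂˣ) : ∃ l : N →* ℂˣ, ∀ m, l (i m) = χ m := by
  have hsurj : ∀ {n : ℕ}, n ≠ 0 → Function.Surjective
      (fun a => n • a : Additive ℂˣ → Additive ℂˣ) := by
    intro n hn a
    obtain ⟨z, hz⟩ := IsAlgClosed.exists_pow_nat_eq (a.toMul : ℂ) (Nat.pos_of_ne_zero hn)
    have hz0 : z ≠ 0 := by
      rintro rfl
      rw [zero_pow hn] at hz
      exact a.toMul.ne_zero hz.symm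
    refine ⟨Additive.ofMul (Units.mk0 z hz0), ?_⟩
    apply Additive.toMul.injective
    apply Units.ext
    simpa using hz
  letI : DivisibleBy (Additive ℂˣ) ℕ := divisibleByOfSMulRightSurj _ _ hsurj
  letI : DivisibleBy (Additive ℂˣ) ℤ := AddGroup.divisibleByIntOfDivisibleByNat _
  obtain ⟨l, hl⟩ := (Module.Baer.of_divisible (Additive ℂˣ)).extension_property_addMonoidHom
    (MonoidHom.toAdditive i) hi (MonoidHom.toAdditive χ)
  exact ⟨MonoidHom.toAdditive.symm l, fun m => congrArg Additive.toMul
    (DFunLike.congr_fun hl (Additive.ofMul m))⟩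

theorem aux_separate {M : Type*} [CommGroup M] (x : M) (hx : x ≠ 1) :
    ∃ χ : M →* ℂˣ, χ x ≠ 1 := by
  obtain ⟨c, hc⟩ := CharacterModule.exists_character_apply_ne_zero_of_ne_zero
    (A := Additive M) (a := Additive.ofMul x) (by simpa using hx)
  let E : ℚ →+ Additive ℂˣ :=
    { toFun := fun q => Additive.ofMul
        (Units.mk0 (Complex.exp (2 * Real.pi * Complex.I * q)) (Complex.exp_ne_zero _))
      map_zero' := by
        apply Additive.toMul.injective
        apply Units.ext
        simp
      map_add' := fun p q => by
        apply Additive.toMul.injective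
        apply Units.ext
        simp [mul_add, Complex.exp_add] }
  have hE : ∀ q : ℚ, E q = 0 ↔ q ∈ AddSubgroup.zmultiples (1 : ℚ) := by
    intro q
    have h1 : E q = 0 ↔ Complex.exp (2 * Real.pi * Complex.I * q) = 1 := by
      constructor
      · intro h
        exact congrArg (fun a : Additive ℂˣ => ((Additive.toMul a : ℂˣ) : ℂ)) h
      · intro h
        apply Additive.toMul.injective
        apply Units.ext
        exact h
    rw [h1, Complex.exp_eq_one_iff, AddSubgroup.mem_zmultiples_iff]
    have h2 : (2 * Real.pi * Complex.I : ℂ) ≠ 0 := Complex.two_pi_I_ne_zero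
    constructor
    · rintro ⟨n, hn⟩
      refine ⟨n, ?_⟩
      rw [mul_comm] at hn
      have := mul_right_cancel₀ h2 hn
      have h3 : q = n := by exact_mod_cast this
      simp [h3]
    · rintro ⟨n, rfl⟩
      exact ⟨n, by simp [mul_comm]⟩
  let L : AddCircle (1 : ℚ) →+ Additive ℂˣ :=
    QuotientAddGroup.lift (AddSubgroup.zmultiples (1 : ℚ)) E (fun q hq => (hE q).2 hq)
  have hL : ∀ t, L t = 0 → t = 0 := by
    intro t
    induction t using QuotientAddGroup.induction_on with
    | H q =>
      intro h
      exact (QuotientAddGroup.eq_zero_iff q).2 ((hE q).1 h)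
  let c' : Additive M →+ AddCircle (1 : ℚ) := c
  refine ⟨MonoidHom.toAdditive.symm (L.comp c'), fun h => hc (hL _ ?_)⟩
  exact congrArg Additive.ofMul h

theorem aux_ac1 {M : Type*} [CommGroup M] (x y c : M) : x * y * c * c = x * c * (y * c) := by
  rw [mul_mul_mul_comm, mul_assoc]

theorem aux_ac2 {M : Type*} [CommGroup M] (x y u v w : M) :
    x * y * (u * v * w⁻¹) * w = x * u * (y * v) := by
  rw [mul_assoc (x * y), inv_mul_cancel_right, mul_mul_mul_comm]

variable {G : Type*} [Group G]

/-- the central extension attached to a cocycle -/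
structure TwExt (α : G → G → ℂˣ) where
  fst : G
  snd : ℂˣ

theorem TwExt.ext' {α : G → G → ℂˣ} {x y : TwExt α} (h1 : x.fst = y.fst) (h2 : x.snd = y.snd) :
    x = y := by
  cases x; cases y; simp_all

theorem aux_one_left (α : G → G → ℂˣ)
    (hα : ∀ g h k : G, α g h * α (g * h) k = α h k * α g (h * k)) (k : G) :
    α 1 k = α 1 1 := by
  have := hα 1 1 k
  simp only [one_mul] at this
  rw [mul_comm] at this
  exact (mul_left_cancel this).symm

/-- the group structure -/
@[reducible] def TwExt.group (α : G → G → ℂˣ)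
    (hα : ∀ g h k : G, α g h * α (g * h) k = α h k * α g (h * k)) : Group (TwExt α) :=
  letI : Mul (TwExt α) := ⟨fun x y => ⟨x.fst * y.fst, x.snd * y.snd * α x.fst y.fst⟩⟩
  letI : One (TwExt α) := ⟨⟨1, (α 1 1)⁻¹⟩⟩
  letI : Inv (TwExt α) := ⟨fun x => ⟨x.fst⁻¹, (α 1 1)⁻¹ * x.snd⁻¹ * (α x.fst⁻¹ x.fst)⁻¹⟩⟩
  Group.ofLeftAxioms
    (fun x y z => by
      apply TwExt.ext'
      · exact mul_assoc _ _ _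
      · change x.snd * y.snd * α x.fst y.fst * z.snd * α (x.fst * y.fst) z.fst
          = x.snd * (y.snd * z.snd * α y.fst z.fst) * α x.fst (y.fst * z.fst)
        calc _ = x.snd * y.snd * z.snd * (α x.fst y.fst * α (x.fst * y.fst) z.fst) := by
              simp only [mul_assoc, mul_comm, mul_left_comm]
          _ = _ := by
              rw [hα]; simp only [mul_assoc, mul_comm, mul_left_comm])
    (fun x => by
      apply TwExt.ext'
      · exact one_mul _
      · change (α 1 1)⁻¹ * x.snd * α 1 x.fst = x.snd
        rw [aux_one_left α hα x.fst, mul_comm, mul_inv_cancel_left])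
    (fun x => by
      apply TwExt.ext'
      · exact inv_mul_cancel _
      · change (α 1 1)⁻¹ * x.snd⁻¹ * (α x.fst⁻¹ x.fst)⁻¹ * x.snd * α x.fst⁻¹ x.fst = (α 1 1)⁻¹
        rw [mul_right_comm _ _ x.snd, inv_mul_cancel_right, inv_mul_cancel_right])

theorem aux_central (π : Rack.EnvelGroup (Quandle.Conj G) →* G)
    (hπ : ∀ g : G, π (Rack.toEnvelGroup (Quandle.Conj G) g) = g) :
    (∀ (a : Rack.EnvelGroup (Quandle.Conj G)), π a = 1 → ∀ b, a * b = b * a) := by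
  let e : G → Rack.EnvelGroup (Quandle.Conj G) := fun g => Rack.toEnvelGroup (Quandle.Conj G) g
  have ind : ∀ (S : Subgroup (Rack.EnvelGroup (Quandle.Conj G))), (∀ g, e g ∈ S) →
      ∀ a, a ∈ S := by
    intro S hS a
    induction a using Quotient.inductionOn with
    | h a =>
      induction a with
      | unit => exact S.one_mem
      | incl x => exact hS x
      | mul x y hx hy => exact S.mul_mem hx hy
      | inv x hx => exact S.inv_mem hx
  have hconj : ∀ g h : G, e g * e h * (e g)⁻¹ = e (g * h * g⁻¹) := fun g h =>
    ((Rack.toEnvelGroup (Quandle.Conj G)).map_act (x := g) (y := h)).symm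
  have hact : ∀ a, ∀ h : G, a * e h * a⁻¹ = e (π a * h * (π a)⁻¹) := by
    let S : Subgroup (Rack.EnvelGroup (Quandle.Conj G)) :=
      { carrier := {a | ∀ h : G, a * e h * a⁻¹ = e (π a * h * (π a)⁻¹)}
        one_mem' := by intro h; simp
        mul_mem' := by
          intro a b ha hb h
          have := ha (π b * h * (π b)⁻¹)
          rw [← hb h] at this
          simpa [mul_assoc] using this
        inv_mem' := by
          intro a ha h
          have := ha (π a⁻¹ * h * (π a⁻¹)⁻¹)
          have h2 : π a * (π a⁻¹ * h * (π a⁻¹)⁻¹) * (π a)⁻¹ = h := by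
            simp [mul_assoc]
          rw [h2] at this
          rw [← this]
          simp [mul_assoc] }
    apply ind S
    intro g h
    rw [hconj, hπ]
  intro a ha b
  refine (Subgroup.mem_centralizer_singleton_iff.1 (?_ : b ∈ Subgroup.centralizer {a})).symm
  apply ind
  intro h
  rw [Subgroup.mem_centralizer_singleton_iff]
  have := hact a h
  rw [ha] at this
  simp only [one_mul, inv_one, mul_one] at this
  rw [mul_inv_eq_iff_eq_mul] at this
  exact this.symm

end Helpers

/-- For a finite group `G`, with `π : A(G) → G` the canonical homomorphism and
`Ab : A(G) → A(G)^{ab}` the abelianization map, the homomorphism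
`π × Ab : A(G) → G × A(G)^{ab}` is injective iff every symmetric 2-cocycle on `G` with values
in `ℂˣ` is a coboundary. -/
theorem stmt17 {G : Type*} [Group G] [Finite G]
    (π : Rack.EnvelGroup (Quandle.Conj G) →* G)
    (hπ : ∀ g : G, π (Rack.toEnvelGroup (Quandle.Conj G) g) = g) :
    Function.Injective
      (fun a : Rack.EnvelGroup (Quandle.Conj G) => (π a, Abelianization.of a)) ↔
      (∀ α : G → G → ℂˣ,
        (∀ g h k : G, α g h * α (g * h) k = α h k * α g (h * k)) →
        (∀ g h : G, α g h = α h g) →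
        ∃ f : G → ℂˣ, ∀ g h : G, α g h = f g * f h * (f (g * h))⁻¹) := by
  classical
  have hcent := aux_central π hπ
  let e : G → Rack.EnvelGroup (Quandle.Conj G) := fun g => Rack.toEnvelGroup (Quandle.Conj G) g
  have hπe : ∀ g, π (e g) = g := hπ
  have hconj : ∀ g h : G, e g * e h * (e g)⁻¹ = e (g * h * g⁻¹) := fun g h =>
    ((Rack.toEnvelGroup (Quandle.Conj G)).map_act (x := g) (y := h)).symm
  letI : CommGroup π.ker :=
    { (inferInstance : Group π.ker) with
      mul_comm := fun a b => Subtype.ext (hcent a.1 a.2 b.1) }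
  constructor
  · intro hinj α hα hsym
    letI := TwExt.group α hα
    have hmul : ∀ x y : TwExt α,
      x * y = ⟨x.fst * y.fst, x.snd * y.snd * α x.fst y.fst⟩ := fun _ _ => rfl
    have hone : (1 : TwExt α) = ⟨1, (α 1 1)⁻¹⟩ := rfl
    let s : ShelfHom (Quandle.Conj G) (Quandle.Conj (TwExt α)) :=
      { toFun := fun g => (⟨g, 1⟩ : TwExt α)
        map_act' := by
          intro g h
          change (⟨g * h * g⁻¹, 1⟩ : TwExt α) = (⟨g, 1⟩ : TwExt α) * ⟨h, 1⟩ * (⟨g, 1⟩ : TwExt α)⁻¹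
          rw [eq_mul_inv_iff_mul_eq, hmul, hmul]
          apply TwExt.ext'
          · simp
          · have := hα g (h * g⁻¹) g
            rw [hsym g (h * g⁻¹), inv_mul_cancel_right, ← mul_assoc] at this
            simpa using mul_left_cancel this }
    let Φ : Rack.EnvelGroup (Quandle.Conj G) →* TwExt α := Rack.toEnvelGroup.map s
    have hΦe : ∀ g, Φ (e g) = ⟨g, 1⟩ := fun g => rfl
    let p : TwExt α →* G :=
      { toFun := TwExt.fst, map_one' := rfl, map_mul' := fun _ _ => rfl }
    have hp : p.comp Φ = π := by
      apply Rack.toEnvelGroup.map.symm.injective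
      apply DFunLike.ext
      intro g
      exact (hπ g).symm
    have hΦ1 : ∀ a, (Φ a).fst = π a := fun a => DFunLike.congr_fun hp a
    let χ : π.ker →* ℂˣ :=
      { toFun := fun k => (Φ k.1).snd * α 1 1
        map_one' := by
          change (Φ 1).snd * α 1 1 = 1
          rw [map_one, hone]; simp
        map_mul' := by
          intro a b
          change (Φ (a.1 * b.1)).snd * α 1 1 = _
          rw [map_mul, hmul]
          have ha : (Φ a.1).fst = 1 := (hΦ1 _).trans a.2
          have hb : (Φ b.1).fst = 1 := (hΦ1 _).trans b.2
          rw [ha, hb]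
          exact aux_ac1 _ _ _ }
    let i : π.ker →* Abelianization (Rack.EnvelGroup (Quandle.Conj G)) :=
      Abelianization.of.comp π.ker.subtype
    have hi : Function.Injective i := by
      intro a b hab
      apply Subtype.ext
      apply hinj
      exact Prod.ext (a.2.trans b.2.symm) hab
    obtain ⟨l, hl⟩ := aux_extend i hi χ
    refine ⟨fun g => l (Abelianization.of (e g)), fun g h => ?_⟩
    have hk : e g * e h * (e (g * h))⁻¹ ∈ π.ker := by
      rw [MonoidHom.mem_ker]; simp [hπe]
    have h1 := hl ⟨_, hk⟩
    have h2 : l (i ⟨_, hk⟩) = l (Abelianization.of (e g)) * l (Abelianization.of (e h)) *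
        (l (Abelianization.of (e (g * h))))⁻¹ := by
      change l (Abelianization.of (e g * e h * (e (g * h))⁻¹)) = _
      simp only [map_mul, map_inv]
    rw [← h2, h1]
    change α g h = (Φ (e g * e h * (e (g * h))⁻¹)).snd * α 1 1
    have h3 : Φ (e g * e h * (e (g * h))⁻¹) * Φ (e (g * h)) = Φ (e g) * Φ (e h) := by
      rw [← map_mul Φ, ← map_mul Φ, inv_mul_cancel_right]
    have h4 : (Φ (e g * e h * (e (g * h))⁻¹)).fst = 1 := (hΦ1 _).trans hk
    have h5 := congrArg TwExt.snd h3
    rw [hmul, hmul] at h5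
    simp only [h4, hΦe, mul_one, one_mul] at h5
    rw [aux_one_left α hα] at h5
    exact h5.symm
  · intro hcob
    let F0 : Rack.EnvelGroup (Quandle.Conj G) →* G × Abelianization _ :=
      π.prod Abelianization.of
    change Function.Injective F0
    rw [injective_iff_map_eq_one]
    intro x hx
    by_contra hx1
    have hx2 : π x = 1 := congrArg Prod.fst hx
    have hx3 : Abelianization.of x = 1 := congrArg Prod.snd hx
    obtain ⟨χ, hχ⟩ := aux_separate (⟨x, hx2⟩ : π.ker) (fun h => hx1 (congrArg Subtype.val h))
    have hrk : ∀ a, a * (e (π a))⁻¹ ∈ π.ker := by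
      intro a; rw [MonoidHom.mem_ker]; simp [hπe]
    let r : Rack.EnvelGroup (Quandle.Conj G) → π.ker := fun a => ⟨a * (e (π a))⁻¹, hrk a⟩
    have hbk : ∀ g h, e g * e h * (e (g * h))⁻¹ ∈ π.ker := by
      intro g h; rw [MonoidHom.mem_ker]; simp [hπe]
    let β : G → G → π.ker := fun g h => ⟨e g * e h * (e (g * h))⁻¹, hbk g h⟩
    have hr : ∀ a b, r (a * b) = r a * r b * β (π a) (π b) := by
      intro a b
      apply Subtype.ext
      change a * b * (e (π (a * b)))⁻¹ = a * (e (π a))⁻¹ * (b * (e (π b))⁻¹) *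
        (e (π a) * e (π b) * (e (π a * π b))⁻¹)
      have := hcent _ (hrk b) (e (π a))
      calc _ = a * (e (π a))⁻¹ * (e (π a) * (b * (e (π b))⁻¹)) * (e (π b) * (e (π a * π b))⁻¹) := by
            rw [map_mul]; group
        _ = _ := by rw [← this]; group
    have hval : ∀ g h, (β g h : Rack.EnvelGroup (Quandle.Conj G)) * e (g * h) = e g * e h := by
      intro g h
      change e g * e h * (e (g * h))⁻¹ * e (g * h) = _
      group
    have hβ : ∀ g h k : G, β g h * β (g * h) k = β h k * β g (h * k) := by
      intro g h k
      apply Subtype.ext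
      apply mul_right_cancel (b := e (g * h * k))
      change (β g h).1 * (β (g * h) k).1 * e (g * h * k) =
        (β h k).1 * (β g (h * k)).1 * e (g * h * k)
      rw [mul_assoc, hval, ← mul_assoc, hval, mul_assoc g h k, mul_assoc (β h k).1, hval,
        ← mul_assoc, hcent _ (β h k).2, mul_assoc (e g), mul_assoc (e g), hval]
    have hβs : ∀ g h : G, β g h = β h g := by
      intro g h
      apply Subtype.ext
      have h1 := hcent _ (β g h).2 (e g)
      change e g * e h * (e (g * h))⁻¹ * e g = e g * (e g * e h * (e (g * h))⁻¹) at h1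
      have h2 := hconj g (h * g)
      have h3 : g * (h * g) * g⁻¹ = g * h := by group
      rw [h3] at h2
      change e g * e h * (e (g * h))⁻¹ = e h * e g * (e (h * g))⁻¹
      have h4 : e g * (e g * e h * (e (g * h))⁻¹) = e g * (e h * e g * (e (h * g))⁻¹) := by
        rw [← h1, ← h2]; group
      exact mul_left_cancel h4
    obtain ⟨f, hf⟩ := hcob (fun g h => χ (β g h))
      (fun g h k => by simp only [← map_mul, hβ]) (fun g h => by simp only [hβs g h])
    let F : Rack.EnvelGroup (Quandle.Conj G) →* ℂˣ :=
      MonoidHom.mk' (fun a => χ (r a) * f (π a)) (by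
        intro a b
        rw [hr, map_mul, map_mul, map_mul, hf]
        exact aux_ac2 _ _ _ _ _)
    have hF : F x = 1 := by
      have : Abelianization.lift F (Abelianization.of x) = F x := by simp
      rw [← this, hx3, map_one]
    apply hχ
    have hF' : χ (r x) * f (π x) = 1 := hF
    have hxr : (⟨x, hx2⟩ : π.ker) = r x * β 1 1 := by
      apply Subtype.ext
      change x = x * (e (π x))⁻¹ * (e 1 * e 1 * (e (1 * 1))⁻¹)
      rw [hx2, mul_one]; group
    rw [hxr, map_mul, hf 1 1]
    rw [hx2] at hF'
    simpa using hF'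
end
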